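/- Let n be a positive integer with n ≡ 5 (mod 9) or n ≡ 8 (mod 9). Then ∑_{k=0}^{n−1} (q^4;q^9)_k (q^4;q^9)_k (q;q^9)_k · q^{9k} / (q^9;q^9)_k^3 ≡ 0 (mod Φ_n(q)^2), as rational functions of q over ℚ. -/

import Mathlib

open Finset Polynomial

/-- The q-shifted factorial `(x; q)_k = ∏_{j=0}^{k-1} (1 - x q^j)` in `RatFunc ℚ`. -/
noncomputable def qPoch (x q : RatFunc ℚ) (k : ℕ) : RatFunc ℚ :=
  ∏ j ∈ Finset.range k, (1 - x * q ^ j)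

/-- `A ≡ 0 (mod P)`: `A = P · B` for some rational function `B` whose denominator
(in lowest terms) is coprime to `P`. -/
def CongrZero (A : RatFunc ℚ) (P : Polynomial ℚ) : Prop :=
  ∃ B : RatFunc ℚ, A = algebraMap (Polynomial ℚ) (RatFunc ℚ) P * B ∧ IsCoprime B.denom P

lemma qPoch_zero (x q : RatFunc ℚ) : qPoch x q 0 = 1 := by simp [qPoch]

lemma qPoch_succ (x q : RatFunc ℚ) (k : ℕ) :
    qPoch x q (k + 1) = qPoch x q k * (1 - x * q ^ k) := by
  simp [qPoch, Finset.prod_range_succ]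

lemma qPoch_self_ne_zero {Q : RatFunc ℚ} (hQ : ∀ k : ℕ, 1 - Q * Q ^ k ≠ 0) (k : ℕ) :
    qPoch Q Q k ≠ 0 :=
  Finset.prod_ne_zero_iff.mpr fun j _ => hQ j

/-- The summand of the convolution form of the `q`-Pfaff–Saalschütz sum. -/
noncomputable def saalschutzTerm (a b e Q : RatFunc ℚ) (N k : ℕ) : RatFunc ℚ :=
  qPoch a Q k * qPoch b Q k * e ^ k * qPoch e Q (N - k)
    / (qPoch Q Q k ^ 2 * qPoch Q Q (N - k))

/-- The Wilf–Zeilberger relation behind the `q`-Pfaff–Saalschütz sum. -/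
lemma saalschutzTerm_telescope {a b e Q : RatFunc ℚ} (ha : a ≠ 0) (hb : b ≠ 0)
    (he : a * b * e = Q) (hQ : ∀ k : ℕ, 1 - Q * Q ^ k ≠ 0) (k m : ℕ) :
    (1 - Q ^ (k + m + 1)) ^ 2 * saalschutzTerm a b e Q (k + m + 1) k
      - (1 - Q ^ (k + m + 1) / a) * (1 - Q ^ (k + m + 1) / b) * saalschutzTerm a b e Q (k + m) k
    = -Q ^ m * (1 - Q ^ (k + 1)) ^ 2 * saalschutzTerm a b e Q (k + m + 1) (k + 1)
      + Q ^ (m + 1) * (1 - Q ^ k) ^ 2 * saalschutzTerm a b e Q (k + m + 1) k := by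
  have h1 : k + m + 1 - k = m + 1 := by omega
  have h2 : k + m - k = m := by omega
  have h3 : k + m + 1 - (k + 1) = m := by omega
  have hk := qPoch_self_ne_zero hQ k
  have hm := qPoch_self_ne_zero hQ m
  have hk1 := hQ k
  have hm1 := hQ m
  simp only [saalschutzTerm, h1, h2, h3, qPoch_succ]
  generalize qPoch Q Q k = u at *
  generalize qPoch Q Q m = v at *
  generalize qPoch a Q k = A at *
  generalize qPoch b Q k = B at *
  generalize qPoch e Q m = E at *
  simp only [pow_succ, pow_add]
  simp only [pow_zero, one_mul]
  generalize Q ^ k = x at *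
  generalize Q ^ m = y at *
  have hk2 : 1 - x * Q ≠ 0 := by rwa [mul_comm]
  have hm2 : 1 - y * Q ≠ 0 := by rwa [mul_comm]
  field_simp
  subst he
  ring

/-- The convolution form of the `q`-Pfaff–Saalschütz sum. -/
lemma sum_saalschutzTerm {a b e Q : RatFunc ℚ} (ha : a ≠ 0) (hb : b ≠ 0)
    (he : a * b * e = Q) (hQ : ∀ k : ℕ, 1 - Q * Q ^ k ≠ 0) (N : ℕ) :
    ∑ k ∈ range (N + 1), saalschutzTerm a b e Q N k
      = qPoch (Q / a) Q N * qPoch (Q / b) Q N / qPoch Q Q N ^ 2 := by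
  induction N with
  | zero => simp [saalschutzTerm, qPoch_zero]
  | succ N ih =>
    obtain ⟨G, hG⟩ : ∃ G : ℕ → RatFunc ℚ, ∀ k, G k =
        -Q ^ (N + 1 - k) * (1 - Q ^ k) ^ 2 * saalschutzTerm a b e Q (N + 1) k := ⟨_, fun _ => rfl⟩
    have hsum : ∑ k ∈ range (N + 1),
        ((1 - Q ^ (N + 1)) ^ 2 * saalschutzTerm a b e Q (N + 1) k
          - (1 - Q ^ (N + 1) / a) * (1 - Q ^ (N + 1) / b) * saalschutzTerm a b e Q N k)
        = ∑ k ∈ range (N + 1), (G (k + 1) - G k) := by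
      refine Finset.sum_congr rfl fun k hk => ?_
      obtain ⟨m, rfl⟩ := Nat.exists_eq_add_of_le (Nat.lt_succ_iff.mp (mem_range.mp hk))
      rw [saalschutzTerm_telescope ha hb he hQ, hG, hG]
      have h1 : k + m + 1 - k = m + 1 := by omega
      have h3 : k + m + 1 - (k + 1) = m := by omega
      simp only [h1, h3]
      ring
    rw [Finset.sum_range_sub, Finset.sum_sub_distrib, ← Finset.mul_sum, ← Finset.mul_sum, ih, hG,
      hG] at hsum
    simp only [Nat.sub_self, pow_zero, sub_self] at hsum
    have hN := qPoch_self_ne_zero hQ N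
    have hN1 := hQ N
    rw [Finset.sum_range_succ, qPoch_succ, qPoch_succ, qPoch_succ]
    have hp : Q ^ (N + 1) = Q * Q ^ N := by ring
    rw [hp] at hsum
    rw [eq_div_iff (pow_ne_zero 2 (mul_ne_zero hN hN1))]
    have h4 : Q / a * Q ^ N = Q * Q ^ N / a := by ring
    have h5 : Q / b * Q ^ N = Q * Q ^ N / b := by ring
    rw [h4, h5]
    generalize 1 - Q * Q ^ N / a = α at *
    generalize 1 - Q * Q ^ N / b = β at *
    field_simp at hsum
    linear_combination hsum

/-- Reversal of the terminating factor in a `q`-hypergeometric summand. -/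
lemma qPoch_reverse {Q e : RatFunc ℚ} (hQ0 : Q ≠ 0) (hQ : ∀ k : ℕ, 1 - Q * Q ^ k ≠ 0) (N k : ℕ)
    (he : e * Q ^ N = 1) (hk : k ≤ N) :
    qPoch e Q N / qPoch Q Q N * (qPoch e Q k * Q ^ k / qPoch Q Q k)
      = e ^ k * qPoch e Q (N - k) / qPoch Q Q (N - k) := by
  induction k with
  | zero => simp [qPoch_zero]
  | succ k ih =>
    obtain ⟨m, rfl⟩ := Nat.exists_eq_add_of_le hk
    have h1 : k + 1 + m - k = m + 1 := by omega
    have h2 : k + 1 + m - (k + 1) = m := by omega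
    have ih := ih (by omega)
    rw [h1, qPoch_succ, qPoch_succ] at ih
    rw [h2, qPoch_succ, qPoch_succ]
    have hk' := qPoch_self_ne_zero hQ k
    have hm := qPoch_self_ne_zero hQ m
    have hk1 := hQ k
    have hm1 := hQ m
    have key : ∀ C u v w z : RatFunc ℚ, C * (u * Q ^ k / v) = w * (1 - e * Q ^ m) / (z * (1 - Q * Q ^ m)) →
        v ≠ 0 → z ≠ 0 → C * (u * (1 - e * Q ^ k) * Q ^ (k + 1) / (v * (1 - Q * Q ^ k)))
          = e * w / z := by
      intro C u v w z h hv hz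
      rw [pow_succ]
      have : C * (u * (1 - e * Q ^ k) * (Q ^ k * Q) / (v * (1 - Q * Q ^ k)))
        = C * (u * Q ^ k / v) * ((1 - e * Q ^ k) * Q / (1 - Q * Q ^ k)) := by
        rw [mul_div_mul_comm, mul_div_assoc, mul_div_assoc]
        ring
      rw [this, h]
      have he' : e = 1 / (Q ^ k * Q ^ m * Q) := by
        rw [eq_div_iff (by positivity), ← he]; ring
      have hx : Q ^ k ≠ 0 := pow_ne_zero k hQ0
      have hy : Q ^ m ≠ 0 := pow_ne_zero m hQ0
      rw [he']
      generalize Q ^ k = x at *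
      generalize Q ^ m = y at *
      have hk2 : 1 - x * Q ≠ 0 := by rwa [mul_comm]
      have hm2 : 1 - y * Q ≠ 0 := by rwa [mul_comm]
      field_simp
      ring
    rw [key _ _ _ (e ^ k * qPoch e Q m) _ (by rw [ih]; ring) hk' hm]
    ring

/-- The rational functions without pole along `P`. -/
noncomputable def regularAlong (P : ℚ[X]) : Subring (RatFunc ℚ) where
  carrier := {f | IsCoprime f.denom P}
  mul_mem' {f g} hf hg := (IsCoprime.mul_left hf hg).of_isCoprime_of_dvd_left (RatFunc.denom_mul_dvd f g)
  one_mem' := by simp [isCoprime_one_left]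
  add_mem' {f g} hf hg := (IsCoprime.mul_left hf hg).of_isCoprime_of_dvd_left (RatFunc.denom_add_dvd f g)
  zero_mem' := by simp [isCoprime_one_left]
  neg_mem' {f} hf := by
    have h : (-f).denom ∣ f.denom := by
      have := RatFunc.denom_mul_dvd (algebraMap ℚ[X] (RatFunc ℚ) (-1)) f
      rwa [RatFunc.denom_algebraMap, one_mul, map_neg, map_one, neg_one_mul] at this
    exact IsCoprime.of_isCoprime_of_dvd_left hf h

lemma congrZero_sq_iff {A : RatFunc ℚ} {P : ℚ[X]} :
    CongrZero A (P ^ 2) ↔ ∃ B ∈ regularAlong P, A = algebraMap ℚ[X] (RatFunc ℚ) P ^ 2 * B := by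
  constructor
  · rintro ⟨B, h, hB⟩
    exact ⟨B, (IsCoprime.pow_right_iff two_pos).mp hB, by rw [h, map_pow]⟩
  · rintro ⟨B, hB, h⟩
    exact ⟨B, by rw [h, map_pow], (IsCoprime.pow_right_iff two_pos).mpr hB⟩

lemma CongrZero.add_sq {A A' : RatFunc ℚ} {P : ℚ[X]} (h : CongrZero A (P ^ 2))
    (h' : CongrZero A' (P ^ 2)) : CongrZero (A + A') (P ^ 2) := by
  rw [congrZero_sq_iff] at *
  obtain ⟨B, hB, rfl⟩ := h
  obtain ⟨B', hB', rfl⟩ := h'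
  exact ⟨B + B', add_mem hB hB', by ring⟩

lemma CongrZero.mul_sq {A c : RatFunc ℚ} {P : ℚ[X]} (h : CongrZero A (P ^ 2))
    (hc : c ∈ regularAlong P) : CongrZero (A * c) (P ^ 2) := by
  rw [congrZero_sq_iff] at *
  obtain ⟨B, hB, rfl⟩ := h
  exact ⟨B * c, mul_mem hB hc, by ring⟩

lemma congrZero_sq_zero (P : ℚ[X]) : CongrZero 0 (P ^ 2) :=
  congrZero_sq_iff.mpr ⟨0, zero_mem _, by simp⟩

lemma algebraMap_mem_regularAlong (P p : ℚ[X]) :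
    algebraMap ℚ[X] (RatFunc ℚ) p ∈ regularAlong P := by
  change IsCoprime (RatFunc.denom _) P
  simp [isCoprime_one_left]

lemma inv_algebraMap_mem_regularAlong {P p : ℚ[X]} (h : IsCoprime p P) :
    (algebraMap ℚ[X] (RatFunc ℚ) p)⁻¹ ∈ regularAlong P := by
  have := RatFunc.denom_div_dvd (1 : ℚ[X]) p
  rw [map_one, one_div] at this
  exact h.of_isCoprime_of_dvd_left this

lemma isCoprime_one_sub_X_pow_cyclotomic {n m : ℕ} (hn : 0 < n) (h : ¬ n ∣ m) :
    IsCoprime (1 - X ^ m : ℚ[X]) (cyclotomic n ℚ) := by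
  refine ((cyclotomic.irreducible_rat hn).coprime_iff_not_dvd.mpr fun hd => h ?_).symm
  have hζ := Complex.isPrimitiveRoot_exp n hn.ne'
  refine hζ.dvd_of_pow_eq_one m ?_
  obtain ⟨r, hr⟩ := hd
  have hr' := congrArg (aeval (Complex.exp (2 * Real.pi * Complex.I / n))) hr
  have h0 : aeval (Complex.exp (2 * Real.pi * Complex.I / n)) (cyclotomic n ℚ) = 0 := by
    have := hζ.isRoot_cyclotomic hn
    rwa [IsRoot.def, ← map_cyclotomic n (algebraMap ℚ ℂ), eval_map_algebraMap] at this
  rw [map_mul, h0, zero_mul] at hr'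
  simp only [map_sub, map_one, map_pow, aeval_X] at hr'
  exact (sub_eq_zero.mp hr').symm

lemma isCoprime_X_cyclotomic {n : ℕ} (hn : 0 < n) : IsCoprime (X : ℚ[X]) (cyclotomic n ℚ) := by
  refine IsCoprime.of_isCoprime_of_dvd_right ?_ (cyclotomic.dvd_X_pow_sub_one n ℚ)
  refine ⟨X ^ (n - 1), -1, ?_⟩
  rw [← pow_succ, Nat.sub_add_cancel hn]
  ring

lemma X_zpow_mem_regularAlong {n : ℕ} (hn : 0 < n) (z : ℤ) :
    (RatFunc.X : RatFunc ℚ) ^ z ∈ regularAlong (cyclotomic n ℚ) := by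
  have h1 : (RatFunc.X : RatFunc ℚ) ∈ regularAlong (cyclotomic n ℚ) := by
    rw [← RatFunc.algebraMap_X]; exact algebraMap_mem_regularAlong _ _
  have h2 : (RatFunc.X : RatFunc ℚ)⁻¹ ∈ regularAlong (cyclotomic n ℚ) := by
    rw [← RatFunc.algebraMap_X]
    exact inv_algebraMap_mem_regularAlong (isCoprime_X_cyclotomic hn)
  obtain ⟨k, rfl | rfl⟩ := z.eq_nat_or_neg
  · rw [zpow_natCast]; exact pow_mem h1 k
  · rw [zpow_neg, zpow_natCast, ← inv_pow]; exact pow_mem h2 k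

lemma X_pow_mem_regularAlong {n : ℕ} (hn : 0 < n) (k : ℕ) :
    (RatFunc.X : RatFunc ℚ) ^ k ∈ regularAlong (cyclotomic n ℚ) := by
  simpa using X_zpow_mem_regularAlong hn k

lemma one_sub_X_zpow_mul_pow_mem_regularAlong {n : ℕ} (hn : 0 < n) (z : ℤ) (j : ℕ) :
    1 - (RatFunc.X : RatFunc ℚ) ^ z * (RatFunc.X ^ 9) ^ j ∈ regularAlong (cyclotomic n ℚ) :=
  sub_mem (one_mem _) (mul_mem (X_zpow_mem_regularAlong hn z)
    (pow_mem (X_pow_mem_regularAlong hn 9) j))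

lemma qPoch_mem_regularAlong {n : ℕ} (hn : 0 < n) (z : ℤ) (k : ℕ) :
    qPoch ((RatFunc.X : RatFunc ℚ) ^ z) (RatFunc.X ^ 9) k ∈ regularAlong (cyclotomic n ℚ) :=
  prod_mem fun j _ => one_sub_X_zpow_mul_pow_mem_regularAlong hn z j

lemma inv_qPoch_mem_regularAlong {n : ℕ} (hn : 0 < n) (h9 : n.Coprime 9) {k : ℕ} (hk : k < n) :
    (qPoch ((RatFunc.X : RatFunc ℚ) ^ 9) (RatFunc.X ^ 9) k)⁻¹ ∈ regularAlong (cyclotomic n ℚ) := by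
  rw [qPoch, ← Finset.prod_inv_distrib]
  refine prod_mem fun j hj => ?_
  have hj := mem_range.mp hj
  have hmap : (1 - (RatFunc.X : RatFunc ℚ) ^ 9 * (RatFunc.X ^ 9) ^ j)
      = algebraMap ℚ[X] (RatFunc ℚ) (1 - X ^ (9 * (j + 1))) := by
    simp only [map_sub, map_one, map_pow, RatFunc.algebraMap_X]; ring
  rw [hmap]
  refine inv_algebraMap_mem_regularAlong (isCoprime_one_sub_X_pow_cyclotomic hn fun hd => ?_)
  have := Nat.le_of_dvd (by omega) (h9.dvd_of_dvd_mul_left hd)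
  omega

lemma exists_one_sub_X_zpow {n : ℕ} (hn : 0 < n) (t : ℤ) :
    ∃ c ∈ regularAlong (cyclotomic n ℚ), 1 - (RatFunc.X : RatFunc ℚ) ^ (t * n)
      = algebraMap ℚ[X] (RatFunc ℚ) (cyclotomic n ℚ) * c := by
  have hnat : ∀ k : ℕ, ∃ c ∈ regularAlong (cyclotomic n ℚ),
      1 - (RatFunc.X : RatFunc ℚ) ^ ((k : ℤ) * n)
      = algebraMap ℚ[X] (RatFunc ℚ) (cyclotomic n ℚ) * c := by
    intro k
    have hd : cyclotomic n ℚ ∣ 1 - X ^ (k * n) := by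
      rw [dvd_sub_comm, mul_comm, pow_mul]
      exact (cyclotomic.dvd_X_pow_sub_one n ℚ).trans (sub_one_dvd_pow_sub_one _ _)
    obtain ⟨c, hc⟩ := hd
    refine ⟨algebraMap ℚ[X] (RatFunc ℚ) c, algebraMap_mem_regularAlong _ _, ?_⟩
    rw [← map_mul, ← hc]
    simp only [map_sub, map_one, map_pow, RatFunc.algebraMap_X]
    norm_cast
  obtain ⟨k, rfl | rfl⟩ := t.eq_nat_or_neg
  · exact hnat k
  · obtain ⟨c, hc, h⟩ := hnat k
    refine ⟨-(RatFunc.X ^ (-(k : ℤ) * n) * c), neg_mem (mul_mem (X_zpow_mem_regularAlong hn _) hc), ?_⟩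
    have : (RatFunc.X : RatFunc ℚ) ^ (-(k : ℤ) * n) * RatFunc.X ^ ((k : ℤ) * n) = 1 := by
      rw [← zpow_add₀ RatFunc.X_ne_zero]; simp
    linear_combination (-(RatFunc.X : RatFunc ℚ) ^ (-(k : ℤ) * n)) * h - this

/-- A `q`-shifted factorial with a factor `1 - q ^ (t * n)` is divisible by `Φ_n`. -/
lemma exists_qPoch_eq_cyclotomic_mul {n : ℕ} (hn : 0 < n) {z t : ℤ} {j N : ℕ} (hj : j < N)
    (h : z + 9 * j = t * n) :
    ∃ c ∈ regularAlong (cyclotomic n ℚ), qPoch ((RatFunc.X : RatFunc ℚ) ^ z) (RatFunc.X ^ 9) N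
      = algebraMap ℚ[X] (RatFunc ℚ) (cyclotomic n ℚ) * c := by
  obtain ⟨c, hc, hc'⟩ := exists_one_sub_X_zpow hn t
  refine ⟨c * ∏ i ∈ (range N).erase j, (1 - RatFunc.X ^ z * (RatFunc.X ^ 9) ^ i),
    mul_mem hc (prod_mem fun i _ => one_sub_X_zpow_mul_pow_mem_regularAlong hn z i), ?_⟩
  rw [qPoch, ← Finset.mul_prod_erase _ _ (mem_range.mpr hj), ← mul_assoc, ← hc', ← h,
    zpow_add₀ RatFunc.X_ne_zero, zpow_mul, zpow_natCast]
  rfl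

/-- Shifting the two equal parameters by opposite multiples of `n` does not change the product
modulo `Φ_n ^ 2`. -/
lemma congrZero_qPoch_sq_sub {n : ℕ} (hn : 0 < n) (z s : ℤ) (k : ℕ) :
    CongrZero (qPoch ((RatFunc.X : RatFunc ℚ) ^ z) (RatFunc.X ^ 9) k
        * qPoch ((RatFunc.X : RatFunc ℚ) ^ z) (RatFunc.X ^ 9) k
      - qPoch ((RatFunc.X : RatFunc ℚ) ^ (z - s * n)) (RatFunc.X ^ 9) k
        * qPoch ((RatFunc.X : RatFunc ℚ) ^ (z + s * n)) (RatFunc.X ^ 9) k)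
      (cyclotomic n ℚ ^ 2) := by
  induction k with
  | zero => simpa [qPoch_zero] using congrZero_sq_zero _
  | succ k ih =>
    have hf := one_sub_X_zpow_mul_pow_mem_regularAlong hn z k
    have hfac : CongrZero ((1 - (RatFunc.X : RatFunc ℚ) ^ z * (RatFunc.X ^ 9) ^ k) ^ 2
        - (1 - RatFunc.X ^ (z - s * n) * (RatFunc.X ^ 9) ^ k)
          * (1 - RatFunc.X ^ (z + s * n) * (RatFunc.X ^ 9) ^ k)) (cyclotomic n ℚ ^ 2) := by
      obtain ⟨c, hc, hc'⟩ := exists_one_sub_X_zpow hn s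
      refine congrZero_sq_iff.mpr ⟨c ^ 2 * RatFunc.X ^ (z - s * n) * (RatFunc.X ^ 9) ^ k,
        mul_mem (mul_mem (pow_mem hc 2) (X_zpow_mem_regularAlong hn _))
          (pow_mem (X_pow_mem_regularAlong hn 9) k), ?_⟩
      rw [← mul_assoc, ← mul_assoc, ← mul_pow, ← hc']
      rw [zpow_add₀ RatFunc.X_ne_zero, zpow_sub₀ RatFunc.X_ne_zero]
      have := zpow_ne_zero (s * n) (RatFunc.X_ne_zero (K := ℚ))
      field_simp
      ring
    have h1 := ih.mul_sq (pow_mem hf 2)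
    have h2 := hfac.mul_sq (mul_mem (qPoch_mem_regularAlong hn (z - s * n) k)
      (qPoch_mem_regularAlong hn (z + s * n) k))
    convert h1.add_sq h2 using 1
    simp only [qPoch_succ]
    ring

lemma one_sub_X_pow_nine_ne_zero (k : ℕ) :
    1 - (RatFunc.X : RatFunc ℚ) ^ 9 * (RatFunc.X ^ 9) ^ k ≠ 0 := by
  have hmap : (1 - (RatFunc.X : RatFunc ℚ) ^ 9 * (RatFunc.X ^ 9) ^ k)
      = algebraMap ℚ[X] (RatFunc ℚ) (1 - X ^ (9 * (k + 1))) := by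
    simp only [map_sub, map_one, map_pow, RatFunc.algebraMap_X]; ring
  rw [hmap]
  refine RatFunc.algebraMap_ne_zero (sub_ne_zero.mpr fun h => ?_)
  have := congrArg natDegree h
  simp at this

/-- The terminating sum obtained from the `q`-Pfaff–Saalschütz evaluation. -/
lemma sum_terminating (N : ℕ) (w : ℤ) (hw : w = 9 * N + 4) :
    qPoch (RatFunc.X ^ (4 - w)) (RatFunc.X ^ 9) N / qPoch (RatFunc.X ^ 9) (RatFunc.X ^ 9) N *
      ∑ k ∈ range (N + 1), qPoch ((RatFunc.X : RatFunc ℚ) ^ (4 - w)) (RatFunc.X ^ 9) k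
        * qPoch (RatFunc.X ^ (4 + w)) (RatFunc.X ^ 9) k
        * qPoch (RatFunc.X ^ (1 : ℤ)) (RatFunc.X ^ 9) k * RatFunc.X ^ (9 * k)
        / qPoch (RatFunc.X ^ 9) (RatFunc.X ^ 9) k ^ 3
      = qPoch (RatFunc.X ^ (8 : ℤ)) (RatFunc.X ^ 9) N
        * qPoch (RatFunc.X ^ (5 - w)) (RatFunc.X ^ 9) N
        / qPoch (RatFunc.X ^ 9) (RatFunc.X ^ 9) N ^ 2 := by
  have hX := RatFunc.X_ne_zero (K := ℚ)
  have h9 : (RatFunc.X : RatFunc ℚ) ^ 9 = RatFunc.X ^ (9 : ℤ) := by norm_cast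
  have hQ := one_sub_X_pow_nine_ne_zero
  have hprod : (RatFunc.X : RatFunc ℚ) ^ (1 : ℤ) * RatFunc.X ^ (4 + w) * RatFunc.X ^ (4 - w)
      = RatFunc.X ^ 9 := by
    rw [← zpow_add₀ hX, ← zpow_add₀ hX, h9]; congr 1; ring
  have hs := sum_saalschutzTerm (zpow_ne_zero _ hX) (zpow_ne_zero _ hX) hprod hQ N
  have h8 : (RatFunc.X : RatFunc ℚ) ^ 9 / RatFunc.X ^ (1 : ℤ) = RatFunc.X ^ (8 : ℤ) := by
    rw [h9, ← zpow_sub₀ hX]; norm_num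
  have h5 : (RatFunc.X : RatFunc ℚ) ^ 9 / RatFunc.X ^ (4 + w) = RatFunc.X ^ (5 - w) := by
    rw [h9, ← zpow_sub₀ hX]; congr 1; ring
  rw [h8, h5] at hs
  rw [← hs, Finset.mul_sum]
  refine Finset.sum_congr rfl fun k hk => ?_
  have he : (RatFunc.X : RatFunc ℚ) ^ (4 - w) * (RatFunc.X ^ 9) ^ N = 1 := by
    rw [h9, ← zpow_natCast, ← zpow_mul, ← zpow_add₀ hX, hw]; simp
  have hr := qPoch_reverse (pow_ne_zero 9 hX) hQ N k he (Nat.lt_succ_iff.mp (mem_range.mp hk))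
  have hk0 := qPoch_self_ne_zero hQ k
  rw [saalschutzTerm]
  calc _ = qPoch (RatFunc.X ^ (4 - w)) (RatFunc.X ^ 9) N / qPoch (RatFunc.X ^ 9) (RatFunc.X ^ 9) N *
        (qPoch (RatFunc.X ^ (4 - w)) (RatFunc.X ^ 9) k * (RatFunc.X ^ 9) ^ k
          / qPoch (RatFunc.X ^ 9) (RatFunc.X ^ 9) k)
        * (qPoch (RatFunc.X ^ (4 + w)) (RatFunc.X ^ 9) k
        * qPoch (RatFunc.X ^ (1 : ℤ)) (RatFunc.X ^ 9) k
        / qPoch (RatFunc.X ^ 9) (RatFunc.X ^ 9) k ^ 2) := by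
          rw [pow_mul]; ring
    _ = _ := by rw [hr]; ring

lemma qPoch_eq_zero {x Q : RatFunc ℚ} {N k : ℕ} (h : x * Q ^ N = 1) (hk : N < k) :
    qPoch x Q k = 0 :=
  Finset.prod_eq_zero (mem_range.mpr hk) (by rw [h, sub_self])

lemma inv_qPoch_neg_mem_regularAlong {n : ℕ} (hn : 0 < n) (h9 : n.Coprime 9) {N : ℕ} (hN : N < n) :
    (qPoch ((RatFunc.X : RatFunc ℚ) ^ (-(9 * N : ℤ))) (RatFunc.X ^ 9) N)⁻¹
      ∈ regularAlong (cyclotomic n ℚ) := by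
  have hX := RatFunc.X_ne_zero (K := ℚ)
  have h : qPoch ((RatFunc.X : RatFunc ℚ) ^ (-(9 * N : ℤ))) (RatFunc.X ^ 9) N
      = (∏ j ∈ range N, -(RatFunc.X : RatFunc ℚ) ^ (-(9 * (j + 1) : ℤ)))
        * qPoch (RatFunc.X ^ 9) (RatFunc.X ^ 9) N := by
    rw [qPoch, ← Finset.prod_range_reflect, qPoch, ← Finset.prod_mul_distrib]
    refine Finset.prod_congr rfl fun j hj => ?_
    have hj := mem_range.mp hj
    have h1 : (RatFunc.X : RatFunc ℚ) ^ (-(9 * N : ℤ)) * (RatFunc.X ^ 9) ^ (N - 1 - j)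
        = RatFunc.X ^ (-(9 * (j + 1) : ℤ)) := by
      rw [← pow_mul, ← zpow_natCast, ← zpow_add₀ hX]; congr 1; omega
    have h2 : (RatFunc.X : RatFunc ℚ) ^ (-(9 * (j + 1) : ℤ)) * (RatFunc.X ^ 9 * (RatFunc.X ^ 9) ^ j)
        = 1 := by
      rw [← pow_succ', ← pow_mul, ← zpow_natCast, ← zpow_add₀ hX]; simp
    rw [h1]
    linear_combination -h2
  rw [h, mul_inv, ← Finset.prod_inv_distrib]
  refine mul_mem (prod_mem fun j _ => ?_) (inv_qPoch_mem_regularAlong hn h9 hN)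
  rw [inv_neg, ← zpow_neg]
  exact neg_mem (X_zpow_mem_regularAlong hn _)

lemma congrZero_sq_sum {ι : Type*} {s : Finset ι} {f : ι → RatFunc ℚ} {P : ℚ[X]}
    (h : ∀ i ∈ s, CongrZero (f i) (P ^ 2)) : CongrZero (∑ i ∈ s, f i) (P ^ 2) :=
  Finset.sum_induction f (CongrZero · (P ^ 2)) (fun _ _ => CongrZero.add_sq)
    (congrZero_sq_zero P) h

lemma congrZero_sum_shifted {n N i j : ℕ} (hn : 0 < n) (h9 : n.Coprime 9) (hN : N < n) {s t : ℤ}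
    (hs : s * n = 9 * N + 4) (hi : i < N) (hi' : 8 + 9 * (i : ℤ) = t * n) (hj : j < N)
    (hj' : 5 - s * n + 9 * (j : ℤ) = -t * n) :
    CongrZero (∑ k ∈ range n, qPoch ((RatFunc.X : RatFunc ℚ) ^ (4 - s * n)) (RatFunc.X ^ 9) k
        * qPoch (RatFunc.X ^ (4 + s * n)) (RatFunc.X ^ 9) k
        * qPoch (RatFunc.X ^ (1 : ℤ)) (RatFunc.X ^ 9) k * RatFunc.X ^ (9 * k)
        / qPoch (RatFunc.X ^ 9) (RatFunc.X ^ 9) k ^ 3) (cyclotomic n ℚ ^ 2) := by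
  have he : (4 - s * n : ℤ) = -(9 * N) := by omega
  have hinv := inv_qPoch_neg_mem_regularAlong hn h9 hN
  have hterm : (RatFunc.X : RatFunc ℚ) ^ (4 - s * n) * (RatFunc.X ^ 9) ^ N = 1 := by
    rw [← pow_mul, ← zpow_natCast, ← zpow_add₀ RatFunc.X_ne_zero, he]; simp
  have htrunc := Finset.sum_subset (range_subset_range.mpr hN) (f := fun k =>
      qPoch ((RatFunc.X : RatFunc ℚ) ^ (4 - s * n)) (RatFunc.X ^ 9) k
        * qPoch (RatFunc.X ^ (4 + s * n)) (RatFunc.X ^ 9) k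
        * qPoch (RatFunc.X ^ (1 : ℤ)) (RatFunc.X ^ 9) k * RatFunc.X ^ (9 * k)
        / qPoch (RatFunc.X ^ 9) (RatFunc.X ^ 9) k ^ 3) fun k _ hk => by
    have hk : N < k := by simpa [Nat.lt_succ_iff] using hk
    simp [qPoch_eq_zero hterm hk]
  rw [← htrunc]
  have hsum := sum_terminating N (s * n) hs
  obtain ⟨c, hc, hc'⟩ := exists_qPoch_eq_cyclotomic_mul hn hi hi'
  obtain ⟨d, hd, hd'⟩ := exists_qPoch_eq_cyclotomic_mul hn hj hj'
  rw [hc', hd'] at hsum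
  have hne : qPoch ((RatFunc.X : RatFunc ℚ) ^ (4 - s * n)) (RatFunc.X ^ 9) N ≠ 0 := by
    refine Finset.prod_ne_zero_iff.mpr fun l hl h0 => ?_
    have hl := mem_range.mp hl
    have h1 := one_sub_X_pow_nine_ne_zero (N - l - 1)
    apply h1
    have h2 : (RatFunc.X : RatFunc ℚ) ^ 9 * (RatFunc.X ^ 9) ^ (N - l - 1)
        * (RatFunc.X ^ 9) ^ l = (RatFunc.X ^ 9) ^ N := by
      rw [← pow_succ', ← pow_add]; congr 1; omega
    have h3 : (RatFunc.X : RatFunc ℚ) ^ (4 - s * n) * (RatFunc.X ^ 9) ^ l = 1 :=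
      (sub_eq_zero.mp h0).symm
    linear_combination -(RatFunc.X : RatFunc ℚ) ^ (4 - s * n) * h2 - hterm
      + (RatFunc.X : RatFunc ℚ) ^ 9 * (RatFunc.X ^ 9) ^ (N - l - 1) * h3
  have hne' := qPoch_self_ne_zero one_sub_X_pow_nine_ne_zero N
  refine congrZero_sq_iff.mpr ⟨c * d * (qPoch (RatFunc.X ^ 9) (RatFunc.X ^ 9) N)⁻¹
      * (qPoch (RatFunc.X ^ (4 - s * n)) (RatFunc.X ^ 9) N)⁻¹,
    mul_mem (mul_mem (mul_mem hc hd) (inv_qPoch_mem_regularAlong hn h9 hN))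
      (by rw [he]; exact hinv), ?_⟩
  rw [div_mul_eq_mul_div, div_eq_iff hne'] at hsum
  refine mul_left_cancel₀ hne (hsum.trans ?_)
  field_simp

theorem stmt14 (n : ℕ) (hn : 0 < n) (hmod : n % 9 = 5 ∨ n % 9 = 8) :
    CongrZero
      (∑ k ∈ Finset.range n,
        qPoch ((RatFunc.X : RatFunc ℚ) ^ (4 : ℤ)) (RatFunc.X ^ 9) k
            * qPoch ((RatFunc.X : RatFunc ℚ) ^ (4 : ℤ)) (RatFunc.X ^ 9) k
            * qPoch ((RatFunc.X : RatFunc ℚ) ^ (1 : ℤ)) (RatFunc.X ^ 9) k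
            * RatFunc.X ^ (9 * k)
          / (qPoch ((RatFunc.X : RatFunc ℚ) ^ 9) (RatFunc.X ^ 9) k) ^ 3)
      ((Polynomial.cyclotomic n ℚ) ^ 2) := by
  have h9 : n.Coprime 9 := by
    rw [Nat.coprime_comm, Nat.Coprime, Nat.gcd_rec]
    rcases hmod with h | h <;> rw [h] <;> rfl
  obtain ⟨s, hshift⟩ : ∃ s : ℤ, CongrZero (∑ k ∈ range n,
      qPoch ((RatFunc.X : RatFunc ℚ) ^ (4 - s * n)) (RatFunc.X ^ 9) k
        * qPoch (RatFunc.X ^ (4 + s * n)) (RatFunc.X ^ 9) k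
        * qPoch (RatFunc.X ^ (1 : ℤ)) (RatFunc.X ^ 9) k * RatFunc.X ^ (9 * k)
        / qPoch (RatFunc.X ^ 9) (RatFunc.X ^ 9) k ^ 3) (cyclotomic n ℚ ^ 2) := by
    rcases hmod with h | h
    · exact ⟨8, congrZero_sum_shifted (N := (8 * n - 4) / 9) (i := (7 * n - 8) / 9)
        (j := (n - 5) / 9) (t := 7) hn h9 (by omega) (by omega) (by omega) (by omega) (by omega)
        (by omega)⟩
    · exact ⟨5, congrZero_sum_shifted (N := (5 * n - 4) / 9) (i := (n - 8) / 9)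
        (j := (4 * n - 5) / 9) (t := 1) hn h9 (by omega) (by omega) (by omega) (by omega) (by omega)
        (by omega)⟩
  have hdiff := congrZero_sq_sum fun k (hk : k ∈ range n) =>
    (congrZero_qPoch_sq_sub hn 4 s k).mul_sq
      (mul_mem (mul_mem (qPoch_mem_regularAlong hn 1 k) (X_pow_mem_regularAlong hn (9 * k)))
        (pow_mem (inv_qPoch_mem_regularAlong hn h9 (mem_range.mp hk)) 3))
  convert hdiff.add_sq hshift using 1
  rw [← Finset.sum_add_distrib]
  refine Finset.sum_congr rfl fun k _ => ?_
  rw [div_eq_mul_inv, div_eq_mul_inv, inv_pow]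
  ring
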